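/- Let n < ω and let α be any ordinal. Then Γ_{θ+1} ≤ ψ_0(α) < Ω_0, and Ω_n < ψ_{n+1}(α) < Ω_{n+1}. -/

import Mathlib

open Ordinal Set

/-- The Veblen hierarchy: `phi 0` is the strictly increasing enumeration of the
additively principal ordinals (nonzero ordinals closed under addition), and for `α > 0`,
`phi α` is the strictly increasing enumeration of the common fixed points of the
functions `phi δ` for `δ < α`. -/
noncomputable def phi : Ordinal → Ordinal → Ordinal
  | α => Ordinal.enumOrd {β | (α = 0 → β ≠ 0 ∧ ∀ γ < β, ∀ δ < β, γ + δ < β) ∧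
      ∀ δ, δ < α → phi δ β = β}
termination_by α => α
decreasing_by assumption

/-- `Cr 0` is the class of additively principal ordinals (nonzero ordinals `β` such that
`γ + δ < β` for all `γ, δ < β`); for `α > 0`, `Cr α = {β | ∀ δ < α, phi δ β = β}`.
`phi α` is (definitionally) the strictly increasing enumeration of `Cr α`. -/
def Cr (α : Ordinal) : Set Ordinal :=
  {β | (α = 0 → β ≠ 0 ∧ ∀ γ < β, ∀ δ < β, γ + δ < β) ∧ ∀ δ, δ < α → phi δ β = β}

/-- An ordinal is strongly critical if it is nonzero and closed under `(δ, γ) ↦ phi δ γ`. -/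
def StronglyCritical (α : Ordinal) : Prop :=
  α ≠ 0 ∧ ∀ δ < α, ∀ γ < α, phi δ γ < α

/-- `Gamma β` is the `β`-th strongly critical ordinal. -/
noncomputable def Gamma : Ordinal → Ordinal :=
  Ordinal.enumOrd {α | StronglyCritical α}

/-- An ordinal which is (the initial ordinal of) an uncountable regular cardinal. -/
def IsUncountableRegular (o : Ordinal) : Prop :=
  ∃ κ : Cardinal, Cardinal.aleph0 < κ ∧ κ.IsRegular ∧ o = κ.ord

/-- The base sets `B_n^0(α)` (they do not depend on `α`):
`B_0^0(α) = {0} ∪ {Γ_β : β ≤ θ} ∪ {Ω_m : m ≤ ω}` and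
`B_{n+1}^0(α) = {β : β < Ω_n} ∪ {Ω_m : m ≤ ω}`. -/
def Bbase (θ : Ordinal) (Ω : ℕ → Ordinal) (Ωω : Ordinal) : ℕ → Set Ordinal
  | 0 => {0} ∪ {x | ∃ β ≤ θ, x = Gamma β} ∪ {x | (∃ m : ℕ, x = Ω m) ∨ x = Ωω}
  | n + 1 => {β | β < Ω n} ∪ {x | (∃ m : ℕ, x = Ω m) ∨ x = Ωω}

/-- One closure step, producing `B_n^{k+1}(α)` from `S = B_n^k(α)`, where the function `f`
plays the role of `ψ`:
`S ∪ {δ + δ' : δ, δ' ∈ S} ∪ {phi δ δ' : δ, δ' ∈ S} ∪ {f m δ : m < ω, δ ∈ S, δ < α}`. -/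
def Bstep (f : ℕ → Ordinal → Ordinal) (α : Ordinal) (S : Set Ordinal) : Set Ordinal :=
  S ∪ {x | ∃ δ ∈ S, ∃ δ' ∈ S, x = δ + δ'}
    ∪ {x | ∃ δ ∈ S, ∃ δ' ∈ S, x = phi δ δ'}
    ∪ {x | ∃ m : ℕ, ∃ δ ∈ S, δ < α ∧ x = f m δ}

/-- The sets `B_n^k(α)`, where the function `f` plays the role of `ψ`. -/
def Biter (θ : Ordinal) (Ω : ℕ → Ordinal) (Ωω : Ordinal)
    (f : ℕ → Ordinal → Ordinal) (α : Ordinal) (n : ℕ) : ℕ → Set Ordinal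
  | 0 => Bbase θ Ω Ωω n
  | k + 1 => Bstep f α (Biter θ Ω Ωω f α n k)

/-- `psi θ Ω Ωω n α` is the least ordinal not in `B_n(α) = ⋃ k, B_n^k(α)`.  (The values of
`ψ` are only ever used at arguments `δ < α`, so the guard `if δ < α` does not change the
sets `B_n^k(α)`; it only serves to make the recursion on `α` well-founded.) -/
noncomputable def psi (θ : Ordinal) (Ω : ℕ → Ordinal) (Ωω : Ordinal) : ℕ → Ordinal → Ordinal
  | n, α => sInf {β | β ∉ ⋃ k,
      Biter θ Ω Ωω (fun m δ => if _ : δ < α then psi θ Ω Ωω m δ else 0) α n k}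
termination_by n α => α
decreasing_by assumption

/-- The set `B_n(α) = ⋃ k, B_n^k(α)`. -/
noncomputable def Bset (θ : Ordinal) (Ω : ℕ → Ordinal) (Ωω : Ordinal)
    (n : ℕ) (α : Ordinal) : Set Ordinal :=
  ⋃ k, Biter θ Ω Ωω (fun m δ => if _ : δ < α then psi θ Ω Ωω m δ else 0) α n k

universe u

section

open Cardinal

theorem phi_eq_veblen (α : Ordinal.{u}) : phi α = veblen α := by
  induction α using WellFoundedLT.induction with
  | ind α ih =>
    rw [phi, ← enumOrd_range (veblen_right_strictMono α)]
    congr 1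
    ext β
    obtain rfl | hα := eq_or_ne α 0
    · simp only [forall_const, not_lt_zero, IsEmpty.forall_iff, and_true,
        mem_ofPred_eq, veblen_zero]
      have h := isPrincipal_add_iff_zero_or_omega0_opow (o := β)
      constructor
      · rintro ⟨h0, hβ⟩
        exact (h.1 fun _ _ hx hy ↦ hβ _ hx _ hy).resolve_left h0
      · intro hβ
        refine ⟨?_, fun _ hx _ hy ↦ h.2 (.inr hβ) hx hy⟩
        rintro rfl
        obtain ⟨x, hx⟩ := hβ
        exact (opow_pos x omega0_pos).ne' hx
    · rw [mem_range_veblen hα]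
      simp only [hα, false_implies, true_and, mem_ofPred_eq]
      exact forall₂_congr fun δ hδ ↦ by rw [ih δ hδ]

theorem stronglyCritical_gamma (c : Ordinal) : StronglyCritical (Γ_ c) := by
  refine ⟨gamma_ne_zero, fun δ hδ γ hγ ↦ ?_⟩
  rw [phi_eq_veblen, ← veblen_gamma_zero c, veblen_lt_veblen_iff, veblen_gamma_zero]
  exact .inr (.inl ⟨hδ, hγ⟩)

theorem not_bddAbove_stronglyCritical : ¬ BddAbove {α | StronglyCritical α} := fun h ↦
  strictMono_gamma.not_bddAbove_range_of_wellFoundedLT <|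
    h.mono (range_subset_iff.2 stronglyCritical_gamma)

/-- An ordinal that is neither zero nor strongly critical is a sum or a `phi`-value of
smaller ordinals. -/
theorem exists_eq_add_or_eq_phi {β : Ordinal} (h0 : β ≠ 0) (hβ : ¬ StronglyCritical β) :
    ∃ δ < β, ∃ γ < β, β = δ + γ ∨ β = phi δ γ := by
  by_cases hp : IsPrincipal (· + ·) β
  · obtain ⟨x, hx : ω ^ x = β⟩ := (isPrincipal_add_iff_zero_or_omega0_opow.1 hp).resolve_left h0
    have hxβ : x ≤ β := hx ▸ right_le_opow x one_lt_omega0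
    refine ⟨invVeblen₁ x, ?_, invVeblen₂ x, hx ▸ invVeblen₂_lt x, .inr ?_⟩
    · obtain rfl | hlt := hxβ.eq_or_lt
      · refine invVeblen₁_lt_iff.2 ⟨h0, ?_⟩
        rintro ⟨c, rfl⟩
        exact hβ (stronglyCritical_gamma c)
      · exact (invVeblen₁_le x).trans_lt hlt
    · rw [phi_eq_veblen, veblen_invVeblen₁_invVeblen₂, hx]
  · obtain ⟨δ, hδ, γ, hγ, h⟩ := exists_lt_add_of_not_isPrincipal_add hp
    exact ⟨δ, hδ, γ, hγ, .inl h.symm⟩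

section Closure

variable {θ : Ordinal.{u}} {Ω : ℕ → Ordinal.{u}} {Ωω : Ordinal.{u}} {n : ℕ} {α : Ordinal.{u}}

theorem monotone_Biter (f : ℕ → Ordinal → Ordinal) : Monotone (Biter θ Ω Ωω f α n) :=
  monotone_nat_of_le_succ fun _ _ hx ↦ .inl (.inl (.inl hx))

theorem Bbase_subset_Bset : Bbase θ Ω Ωω n ⊆ Bset θ Ω Ωω n α :=
  fun _ hx ↦ mem_iUnion.2 ⟨0, hx⟩

theorem exists_mem_Biter_of_mem_Bset {δ γ : Ordinal} (hδ : δ ∈ Bset θ Ω Ωω n α)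
    (hγ : γ ∈ Bset θ Ω Ωω n α) :
    ∃ k, δ ∈ Biter θ Ω Ωω (fun m δ ↦ if _ : δ < α then psi θ Ω Ωω m δ else 0) α n k ∧
      γ ∈ Biter θ Ω Ωω (fun m δ ↦ if _ : δ < α then psi θ Ω Ωω m δ else 0) α n k := by
  obtain ⟨i, hi⟩ := mem_iUnion.1 hδ
  obtain ⟨j, hj⟩ := mem_iUnion.1 hγ
  exact ⟨max i j, monotone_Biter _ (le_max_left i j) hi, monotone_Biter _ (le_max_right i j) hj⟩

theorem add_mem_Bset {δ γ : Ordinal} (hδ : δ ∈ Bset θ Ω Ωω n α) (hγ : γ ∈ Bset θ Ω Ωω n α) :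
    δ + γ ∈ Bset θ Ω Ωω n α := by
  obtain ⟨k, hδ, hγ⟩ := exists_mem_Biter_of_mem_Bset hδ hγ
  exact mem_iUnion.2 ⟨k + 1, .inl (.inl (.inr ⟨δ, hδ, γ, hγ, rfl⟩))⟩

theorem phi_mem_Bset {δ γ : Ordinal} (hδ : δ ∈ Bset θ Ω Ωω n α) (hγ : γ ∈ Bset θ Ω Ωω n α) :
    phi δ γ ∈ Bset θ Ω Ωω n α := by
  obtain ⟨k, hδ, hγ⟩ := exists_mem_Biter_of_mem_Bset hδ hγ
  exact mem_iUnion.2 ⟨k + 1, .inl (.inr ⟨δ, hδ, γ, hγ, rfl⟩)⟩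

theorem mem_Bset_zero_of_lt_Gamma {β : Ordinal} (hβ : β < Gamma (θ + 1)) :
    β ∈ Bset θ Ω Ωω 0 α := by
  induction β using WellFoundedLT.induction with
  | ind β ih =>
    obtain rfl | h0 := eq_or_ne β 0
    · exact Bbase_subset_Bset (.inl (.inl rfl))
    by_cases hsc : StronglyCritical β
    · obtain ⟨γ, rfl⟩ := enumOrd_surjective not_bddAbove_stronglyCritical hsc
      have hγ : γ < θ + 1 := (enumOrd_lt_enumOrd not_bddAbove_stronglyCritical).1 hβ
      exact Bbase_subset_Bset (.inl (.inr ⟨γ, Order.lt_add_one_iff.1 hγ, rfl⟩))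
    · obtain ⟨δ, hδ, γ, hγ, h | h⟩ := exists_eq_add_or_eq_phi h0 hsc
      · exact h ▸ add_mem_Bset (ih δ hδ (hδ.trans hβ)) (ih γ hγ (hγ.trans hβ))
      · exact h ▸ phi_mem_Bset (ih δ hδ (hδ.trans hβ)) (ih γ hγ (hγ.trans hβ))

theorem mk_Bstep_le {f : ℕ → Ordinal.{u} → Ordinal.{u}} {S : Set Ordinal.{u}}
    {c : Cardinal.{u + 1}} (hc : ℵ₀ ≤ c) (hS : #S ≤ c) : #(Bstep f α S) ≤ c := by
  have union_le {s t : Set Ordinal.{u}} (hs : #s ≤ c) (ht : #t ≤ c) : #(s ∪ t : Set _) ≤ c :=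
    (mk_union_le s t).trans (add_le_of_le hc hs ht)
  have image2_le (g : Ordinal.{u} → Ordinal.{u} → Ordinal.{u}) : #(image2 g S S) ≤ c :=
    mk_image2_le.trans (mul_le_of_le hc hS hS)
  refine union_le (union_le (union_le hS ?_) ?_) ?_
  · refine (mk_le_mk_of_subset ?_).trans (image2_le (· + ·))
    rintro _ ⟨δ, hδ, γ, hγ, rfl⟩
    exact mem_image2_of_mem hδ hγ
  · refine (mk_le_mk_of_subset ?_).trans (image2_le phi)
    rintro _ ⟨δ, hδ, γ, hγ, rfl⟩
    exact mem_image2_of_mem hδ hγ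
  · have hle : #(image2 (fun (m : ULift.{u + 1} ℕ) δ ↦ f m.down δ) univ S) ≤ c :=
      mk_image2_le.trans (mul_le_of_le hc (by simpa using hc) hS)
    refine (mk_le_mk_of_subset ?_).trans hle
    rintro _ ⟨m, δ, hδ, -, rfl⟩
    exact ⟨⟨m⟩, trivial, δ, hδ, rfl⟩

theorem mk_Bset_le {c : Cardinal.{u + 1}} (hc : ℵ₀ ≤ c) (h : #(Bbase θ Ω Ωω n) ≤ c) :
    #(Bset θ Ω Ωω n α) ≤ c := by
  have hk (k : ℕ) : #(Biter θ Ω Ωω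
      (fun m δ ↦ if _ : δ < α then psi θ Ω Ωω m δ else 0) α n k) ≤ c := by
    induction k with
    | zero => exact h
    | succ k ih => exact mk_Bstep_le hc ih
  have hU := mk_iUnion_le_lift fun k ↦ Biter θ Ω Ωω
    (fun m δ ↦ if _ : δ < α then psi θ Ω Ωω m δ else 0) α n k
  simp only [Cardinal.lift_uzero, mk_nat, lift_aleph0] at hU
  exact hU.trans (mul_le_of_le hc hc (ciSup_le' hk))

theorem psi_eq_sInf_compl : psi θ Ω Ωω n α = sInf (Bset θ Ω Ωω n α)ᶜ := by
  rw [psi]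
  rfl

theorem card_psi_le {c : Cardinal.{u}} (hc : ℵ₀ ≤ c) (h : #(Bbase θ Ω Ωω n) ≤ lift.{u + 1} c) :
    (psi θ Ω Ωω n α).card ≤ c := by
  rw [psi_eq_sInf_compl, ← Cardinal.lift_le.{u + 1}]
  exact (lift_card_sInf_compl_le _).trans (mk_Bset_le (aleph0_le_lift.2 hc) h)

theorem psi_notMem_Bset {c : Cardinal.{u}} (hc : ℵ₀ ≤ c)
    (h : #(Bbase θ Ω Ωω n) ≤ lift.{u + 1} c) : psi θ Ω Ωω n α ∉ Bset θ Ω Ωω n α := by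
  rw [psi_eq_sInf_compl]
  refine csInf_mem (s := (Bset θ Ω Ωω n α)ᶜ) (nonempty_compl.2 fun huniv ↦ ?_)
  have hle := mk_le_mk_of_subset (subset_univ (Iio (Order.succ c).ord))
  rw [← huniv, Cardinal.mk_Iio_ordinal, card_ord] at hle
  exact (Order.lt_succ c).not_ge <|
    Cardinal.lift_le.1 (hle.trans (mk_Bset_le (aleph0_le_lift.2 hc) h))

theorem mk_range_Ω_le : #{x | (∃ m : ℕ, x = Ω m) ∨ x = Ωω} ≤ ℵ₀ := by
  have : {x | (∃ m : ℕ, x = Ω m) ∨ x = Ωω} = range Ω ∪ {Ωω} := by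
    ext x
    simp [or_comm, eq_comm]
  rw [this]
  exact ((countable_range Ω).union (countable_singleton Ωω)).le_aleph0

theorem mk_Bbase_zero_le :
    #(Bbase θ Ω Ωω 0) ≤ lift.{u + 1} (max ℵ₀ (θ + 1).card) := by
  have hc : ℵ₀ ≤ lift.{u + 1} (max ℵ₀ (θ + 1).card) := aleph0_le_lift.2 (le_max_left _ _)
  refine (mk_union_le _ _).trans (add_le_of_le hc ((mk_union_le _ _).trans
    (add_le_of_le hc ?_ ?_)) (mk_range_Ω_le.trans hc))
  · rw [mk_singleton]
    exact one_le_aleph0.trans hc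
  · have : {x | ∃ β ≤ θ, x = Gamma β} = Gamma '' Iio (θ + 1) := by
      ext x
      simp [Order.lt_add_one_iff, eq_comm]
    rw [this]
    refine mk_image_le.trans ?_
    rw [Cardinal.mk_Iio_ordinal, Cardinal.lift_le]
    exact le_max_right _ _

theorem mk_Bbase_succ_le (hΩ : ℵ₀ ≤ (Ω n).card) :
    #(Bbase θ Ω Ωω (n + 1)) ≤ lift.{u + 1} (Ω n).card := by
  have hc := aleph0_le_lift.{u, u + 1}.2 hΩ
  exact (mk_union_le _ _).trans
    (add_le_of_le hc (Cardinal.mk_Iio_ordinal _).le (mk_range_Ω_le.trans hc))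

end Closure

end

/-- For every `n < ω` and every ordinal `α`: `Γ_{θ+1} ≤ ψ_0(α) < Ω_0` and
`Ω_n < ψ_{n+1}(α) < Ω_{n+1}`. -/
theorem psi_bounds (θ : Ordinal) (Ω : ℕ → Ordinal) (Ωω : Ordinal)
    (hΩreg : ∀ n : ℕ, IsUncountableRegular (Ω n)) (hΩωreg : IsUncountableRegular Ωω)
    (hΩmono : ∀ n : ℕ, Ω n < Ω (n + 1)) (hΩltω : ∀ n : ℕ, Ω n < Ωω)
    (hθ : θ < Ω 0)
    (n : ℕ) (α : Ordinal) :
    Gamma (θ + 1) ≤ psi θ Ω Ωω 0 α ∧ psi θ Ω Ωω 0 α < Ω 0 ∧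
      Ω n < psi θ Ω Ωω (n + 1) α ∧ psi θ Ω Ωω (n + 1) α < Ω (n + 1) := by
  obtain ⟨κ₀, hκ₀, -, h₀⟩ := hΩreg 0
  obtain ⟨κ, hκ, -, h⟩ := hΩreg n
  obtain ⟨κ', -, -, h'⟩ := hΩreg (n + 1)
  have hΩn : Cardinal.aleph0 ≤ (Ω n).card := by
    rw [h, Cardinal.card_ord]
    exact hκ.le
  refine ⟨?_, ?_, ?_, ?_⟩
  · by_contra! hlt
    exact psi_notMem_Bset (le_max_left _ _) mk_Bbase_zero_le (mem_Bset_zero_of_lt_Gamma hlt)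
  · rw [h₀, Cardinal.lt_ord] at hθ ⊢
    refine (card_psi_le (le_max_left _ _) mk_Bbase_zero_le).trans_lt (max_lt hκ₀ ?_)
    rw [card_add, card_one]
    exact Cardinal.add_lt_of_lt hκ₀.le hθ (Cardinal.one_lt_aleph0.trans hκ₀)
  · by_contra! hle
    refine psi_notMem_Bset (θ := θ) (Ωω := Ωω) (α := α) hΩn (mk_Bbase_succ_le hΩn)
      (Bbase_subset_Bset ?_)
    obtain heq | hlt := hle.eq_or_lt
    · exact .inr (.inl ⟨n, heq⟩)
    · exact .inl hlt
  · have hlt := hΩmono n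
    rw [h', Cardinal.lt_ord] at hlt ⊢
    exact (card_psi_le hΩn (mk_Bbase_succ_le hΩn)).trans_lt hlt
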